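/- arXiv:2603.06033 — 2 statements merged into one kernel-verified Lean document; each statement's English description precedes it below -/
import Mathlib

section
/- Let v ∈ N be such that M := 𝒟v is a W-lattice, and set Λ₀ = M_τ = ∑_{i≥0} τ^i(M). Then F^{g−1}(Λ₀) ⊆ M, and every τ-stable W-lattice contained in M is contained in F^{g−1}(Λ₀) (so F^{g−1}(Λ₀) is the largest τ-stable lattice contained in M). -/
noncomputable section

open WittVector
open scoped Isocrystal

variable (p : ℕ) [Fact p.Prime] (k : Type*) [Field k] [IsAlgClosed k] [CharP k p]

/-- The Frobenius automorphism `σ` of `K(p, k) = Frac(W(k))`, the unique extension of the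
Witt vector Frobenius (itself the unique lift of `x ↦ x^p` on `k`). -/
def sigmaK : K(p, k) ≃+* K(p, k) := WittVector.FractionRing.frobenius p k

variable (g : ℕ)

/-- `N = K^{2g}`: a pair `(x, y)` encodes the vector `∑ᵢ xᵢ·eᵢ + ∑ᵢ yᵢ·fᵢ` in the basis
`e_1, …, e_g, f_1, …, f_g`. -/
abbrev Nspace := (Fin g → K(p, k)) × (Fin g → K(p, k))

/-- The basis vector `e_i` (0-indexed). -/
def eVec (i : Fin g) : Nspace p k g := (Pi.single i 1, 0)

/-- The basis vector `f_i` (0-indexed). -/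
def fVec (i : Fin g) : Nspace p k g := (0, Pi.single i 1)

/-- The `σ`-semilinear Frobenius `F : N → N`, with `F(e_i) = f_i`, `F(f_i) = p·e_i`. -/
def Fmap (v : Nspace p k g) : Nspace p k g :=
  (fun i => (p : K(p, k)) * sigmaK p k (v.2 i), fun i => sigmaK p k (v.1 i))

/-- The Verschiebung `V = p·F⁻¹ : N → N`, with `V(e_i) = f_i`, `V(f_i) = p·e_i`,
`σ⁻¹`-semilinear. -/
def Vmap (v : Nspace p k g) : Nspace p k g :=
  (fun i => (p : K(p, k)) * (sigmaK p k).symm (v.2 i), fun i => (sigmaK p k).symm (v.1 i))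

/-- `τ = p⁻¹·F²` acts coordinatewise by `σ²`. -/
def tauMap (v : Nspace p k g) : Nspace p k g :=
  (fun i => sigmaK p k (sigmaK p k (v.1 i)), fun i => sigmaK p k (sigmaK p k (v.2 i)))

/-- A `W`-lattice in `N`: a finitely generated `W(k)`-submodule spanning `N` over `K`. -/
def IsLattice (L : Submodule (WittVector p k) (Nspace p k g)) : Prop :=
  L.FG ∧ Submodule.span K(p, k) (L : Set (Nspace p k g)) = ⊤

/-- A Dieudonné lattice: a `W`-lattice `M` with `F(M) ⊆ M` and `p·M ⊆ F(M)`. -/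
def IsDieudonneLattice (M : Submodule (WittVector p k) (Nspace p k g)) : Prop :=
  IsLattice p k g M ∧ (∀ v ∈ M, Fmap p k g v ∈ M) ∧
    ∀ v ∈ M, ∃ w ∈ M, Fmap p k g w = (p : K(p, k)) • v

/-- `L` is `τ`-stable: `τ(L) ⊆ L`. -/
def TauStable (L : Submodule (WittVector p k) (Nspace p k g)) : Prop :=
  ∀ v ∈ L, tauMap p k g v ∈ L

/-- `M_τ = ∑_{i ≥ 0} τ^i(M)`, the `W(k)`-submodule generated by all iterates of `τ`
applied to `M`. -/
def Mtau (M : Submodule (WittVector p k) (Nspace p k g)) :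
    Submodule (WittVector p k) (Nspace p k g) :=
  Submodule.span (WittVector p k) (⋃ i : ℕ, (tauMap p k g)^[i] '' (M : Set (Nspace p k g)))

/-- The symplectic pairing with `⟨e_i, f_{g+1−i}⟩ = 1`, `⟨f_i, e_{g+1−i}⟩ = −1` and all
other pairings of basis vectors zero. -/
def pairN (v w : Nspace p k g) : K(p, k) :=
  ∑ i : Fin g, (v.1 i * w.2 (Fin.rev i) - v.2 i * w.1 (Fin.rev i))

/-- The dual `L^∨ = {x ∈ N : ⟨x, m⟩ ∈ W for all m ∈ L}` of a set `L ⊆ N`. -/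
def dualSet (L : Set (Nspace p k g)) : Set (Nspace p k g) :=
  {x | ∀ m ∈ L, ∃ w : WittVector p k, algebraMap (WittVector p k) K(p, k) w = pairN p k g x m}

/-- `𝒟v`: the `W(k)`-submodule generated by all `F^a V^b v`, `a, b ≥ 0`. -/
def Dspan (v : Nspace p k g) : Submodule (WittVector p k) (Nspace p k g) :=
  Submodule.span (WittVector p k)
    {w | ∃ a b : ℕ, w = (Fmap p k g)^[a] ((Vmap p k g)^[b] v)}

namespace TwistedFrobenius

variable {R N : Type*} [CommRing R] [AddCommGroup N] [Module R N]

/-- An increasing chain argument: a submodule bounded by a Noetherian submodule `B` and stable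
under a surjective semilinear map `E` contains every vector that `E` maps into it. -/
theorem mem_of_map_mem {ρ : R →+* R} (E : N →ₛₗ[ρ] N) (hE : Function.Surjective E)
    (B S : Submodule R N) [IsNoetherian R B] (hB : ∀ x, E x ∈ B → x ∈ B) (hSB : S ≤ B)
    (hS : ∀ x ∈ S, E x ∈ S) {x : N} (hx : E x ∈ S) : x ∈ S := by
  have hmem : ∀ n y, y ∈ (Submodule.comap E)^[n] S ↔ E^[n] y ∈ S := by
    intro n
    induction n with
    | zero => intro y; rfl
    | succ n ih =>
      intro y
      rw [Function.iterate_succ_apply', Submodule.mem_comap, ih, Function.iterate_succ_apply]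
  have hle : ∀ n y, y ∈ (Submodule.comap E)^[n] S → y ∈ B := by
    intro n
    induction n with
    | zero => exact fun y hy => hSB hy
    | succ n ih =>
      intro y hy
      rw [Function.iterate_succ_apply', Submodule.mem_comap] at hy
      exact hB _ (ih _ hy)
  let c : ℕ →o Submodule R B :=
    ⟨fun n => ((Submodule.comap E)^[n] S).comap B.subtype, monotone_nat_of_le_succ fun n y hy => by
      rw [Submodule.mem_comap, hmem] at hy ⊢
      rw [Function.iterate_succ_apply']
      exact hS _ hy⟩
  obtain ⟨n, hn⟩ := monotone_stabilizes_iff_noetherian.mpr ‹IsNoetherian R B› c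
  obtain ⟨y, rfl⟩ := hE.iterate n x
  have hy : y ∈ (Submodule.comap E)^[n + 1] S := by
    rw [hmem, Function.iterate_succ_apply']
    exact hx
  have hy' : (⟨y, hle _ _ hy⟩ : B) ∈ c (n + 1) := hy
  rw [← hn (n + 1) n.le_succ] at hy'
  exact (hmem n y).mp hy'

end TwistedFrobenius

/-- A semilinear injection `F` on `N` together with a semilinear bijection `τ` (with inverse `T`)
commuting with `F` and such that `F² = ϖ τ`. -/
structure TwistedFrobenius {R : Type*} [CommRing R] (ϖ : R) (N : Type*) [AddCommGroup N]
    [Module R N] where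
  σ : R →+* R
  ρ : R →+* R
  ρ' : R →+* R
  F : N →ₛₗ[σ] N
  τ : N →ₛₗ[ρ] N
  T : N →ₛₗ[ρ'] N
  σ_surj : Function.Surjective σ
  σ_ϖ : σ ϖ = ϖ
  ρ'_ϖ : ρ' ϖ = ϖ
  F_inj : Function.Injective F
  τ_T : ∀ x, τ (T x) = x
  T_τ : ∀ x, T (τ x) = x
  F_F : ∀ x, F (F x) = ϖ • τ x
  F_T : ∀ x, F (T x) = T (F x)

namespace TwistedFrobenius

variable {R N : Type*} [CommRing R] [AddCommGroup N] [Module R N] {ϖ : R}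
  (S : TwistedFrobenius ϖ N)

instance : RingHomSurjective S.σ := ⟨S.σ_surj⟩

theorem F_τ (x : N) : S.F (S.τ x) = S.τ (S.F x) := by
  rw [← S.τ_T (S.F (S.τ x)), ← S.F_T, S.T_τ]

theorem smul_eq (x : N) : ϖ • x = S.F (S.F (S.T x)) := by
  rw [S.F_F, S.τ_T]

theorem iterate_F_τ (n : ℕ) (x : N) : S.F^[n] (S.τ x) = S.τ (S.F^[n] x) :=
  Function.Commute.iterate_left (f := S.F) (g := S.τ) S.F_τ n x

theorem iterate_F_smul (n : ℕ) (x : N) : S.F^[n] (ϖ • x) = ϖ • S.F^[n] x := by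
  induction n generalizing x with
  | zero => rfl
  | succ n ih =>
    rw [Function.iterate_succ_apply, map_smulₛₗ, S.σ_ϖ, ih, Function.iterate_succ_apply]

/-- The image of a submodule under `F^n`. -/
def Φ (n : ℕ) (A : Submodule R N) : Submodule R N := (Submodule.map S.F)^[n] A

theorem mem_Φ {n : ℕ} {A : Submodule R N} {x : N} : x ∈ S.Φ n A ↔ ∃ y ∈ A, S.F^[n] y = x := by
  induction n generalizing A with
  | zero => simp [Φ]
  | succ n ih =>
    rw [Φ, Function.iterate_succ_apply, ← Φ, ih]
    simp

theorem Φ_mono (n : ℕ) {A B : Submodule R N} (h : A ≤ B) : S.Φ n A ≤ S.Φ n B := by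
  intro x hx
  obtain ⟨y, hy, rfl⟩ := S.mem_Φ.mp hx
  exact S.mem_Φ.mpr ⟨y, h hy, rfl⟩

theorem Φ_sup (n : ℕ) (A B : Submodule R N) : S.Φ n (A ⊔ B) = S.Φ n A ⊔ S.Φ n B := by
  induction n generalizing A B with
  | zero => rfl
  | succ n ih => exact (congrArg (S.Φ n) (Submodule.map_sup A B S.F)).trans (ih _ _)

theorem Φ_map (n : ℕ) (A : Submodule R N) : S.Φ n (A.map S.F) = S.Φ (n + 1) A := rfl

theorem map_Φ (n : ℕ) (A : Submodule R N) : (S.Φ n A).map S.F = S.Φ (n + 1) A :=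
  (Function.iterate_succ_apply' _ _ _).symm

/-- The span of `v, T v, …, T^{m-1} v`. -/
def Z (v : N) (m : ℕ) : Submodule R N :=
  Submodule.span R (Set.range fun i : Fin m => S.T^[i] v)

theorem T_mem_Z (v : N) {m i : ℕ} (h : i < m) : S.T^[i] v ∈ S.Z v m :=
  Submodule.subset_span ⟨⟨i, h⟩, rfl⟩

theorem mem_Z {v : N} {m : ℕ} {x : N} :
    x ∈ S.Z v m ↔ ∃ a : ℕ → R, ∑ i ∈ Finset.range m, a i • S.T^[i] v = x := by
  rw [Z, Submodule.mem_span_range_iff_exists_fun]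
  constructor
  · rintro ⟨c, rfl⟩
    refine ⟨fun i => if h : i < m then c ⟨i, h⟩ else 0, ?_⟩
    rw [← Fin.sum_univ_eq_sum_range fun i => (if h : i < m then c ⟨i, h⟩ else 0) • S.T^[i] v]
    simp
  · rintro ⟨a, rfl⟩
    exact ⟨fun i => a i, Fin.sum_univ_eq_sum_range (fun i => a i • S.T^[i] v) m⟩

/-- The span of all `F^a V^b v` with `a + b ≥ n`, where `V = F T`. -/
def D (v : N) (n : ℕ) : Submodule R N :=
  Submodule.span R {w | ∃ m i, n ≤ m ∧ i ≤ m ∧ w = S.F^[m] (S.T^[i] v)}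

theorem D_anti (v : N) {m n : ℕ} (h : m ≤ n) : S.D v n ≤ S.D v m :=
  Submodule.span_mono fun _ ⟨a, i, ha, hi, hw⟩ => ⟨a, i, h.trans ha, hi, hw⟩

theorem F_mem_D {v : N} {n : ℕ} {x : N} (hx : x ∈ S.D v n) : S.F x ∈ S.D v n := by
  suffices h : S.D v n ≤ (S.D v n).comap S.F from h hx
  refine Submodule.span_le.mpr ?_
  rintro _ ⟨m, i, hm, hi, rfl⟩
  refine Submodule.subset_span ⟨m + 1, i, by omega, by omega, ?_⟩
  rw [Function.iterate_succ_apply']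

theorem smul_mem_D {v : N} {n : ℕ} {x : N} (hx : x ∈ S.D v n) : ϖ • x ∈ S.D v (n + 1) := by
  suffices h : S.D v n ≤ (S.D v (n + 1)).comap (LinearMap.lsmul R N ϖ) from h hx
  refine Submodule.span_le.mpr ?_
  rintro _ ⟨m, i, hm, hi, rfl⟩
  refine Submodule.subset_span ⟨m + 2, i + 1, by omega, by omega, ?_⟩
  rw [LinearMap.lsmul_apply, ← iterate_F_smul, S.smul_eq, Function.iterate_add_apply S.F m 2,
    Function.iterate_succ_apply' S.T]
  rfl

theorem Φ_Z_le_D (v : N) (n : ℕ) : S.Φ n (S.Z v (n + 1)) ≤ S.D v n := by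
  have key : ∀ n (s : Set N), S.Φ n (Submodule.span R s) = Submodule.span R (S.F^[n] '' s) := by
    intro n
    induction n with
    | zero => intro s; simp [Φ]
    | succ n ih =>
      intro s
      rw [← Φ_map, Submodule.map_span, ih, ← Set.image_comp, Function.iterate_succ]
  rw [Z, key, Submodule.span_le]
  rintro _ ⟨_, ⟨i, rfl⟩, rfl⟩
  exact Submodule.subset_span ⟨n, i, le_rfl, by omega, rfl⟩

theorem D_le_sup (v : N) (n : ℕ) : S.D v n ≤ S.Φ n (S.Z v (n + 1)) ⊔ S.D v (n + 1) := by
  refine Submodule.span_le.mpr ?_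
  rintro _ ⟨m, i, hm, hi, rfl⟩
  rcases hm.eq_or_lt with rfl | hm
  · exact Submodule.mem_sup_left (S.mem_Φ.mpr ⟨_, S.T_mem_Z v (by omega), rfl⟩)
  · exact Submodule.mem_sup_right (Submodule.subset_span ⟨m, i, hm, hi, rfl⟩)

/-- The sum of the images `τ^i(A)`. -/
def Aτ (A : Submodule R N) : Submodule R N :=
  Submodule.span R (⋃ i : ℕ, S.τ^[i] '' (A : Set N))

theorem le_Aτ (A : Submodule R N) : A ≤ S.Aτ A := fun x hx =>
  Submodule.subset_span (Set.mem_iUnion.mpr ⟨0, x, hx, rfl⟩)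

theorem Aτ_le {A B : Submodule R N} (h : A ≤ B) (hB : ∀ x ∈ B, S.τ x ∈ B) : S.Aτ A ≤ B := by
  refine Submodule.span_le.mpr (Set.iUnion_subset fun i => ?_)
  rintro _ ⟨x, hx, rfl⟩
  induction i with
  | zero => exact h hx
  | succ i ih =>
    rw [Function.iterate_succ_apply']
    exact hB _ ih

theorem τ_mem_Aτ {A : Submodule R N} {x : N} (hx : x ∈ S.Aτ A) : S.τ x ∈ S.Aτ A := by
  suffices h : S.Aτ A ≤ (S.Aτ A).comap S.τ from h hx
  refine Submodule.span_le.mpr (Set.iUnion_subset fun i => ?_)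
  rintro _ ⟨x, hx, rfl⟩
  refine Submodule.subset_span (Set.mem_iUnion.mpr ⟨i + 1, x, hx, ?_⟩)
  rw [Function.iterate_succ_apply']

theorem F_mem_Aτ {A : Submodule R N} (hA : ∀ x ∈ A, S.F x ∈ A) {x : N} (hx : x ∈ S.Aτ A) :
    S.F x ∈ S.Aτ A := by
  suffices h : S.Aτ A ≤ (S.Aτ A).comap S.F from h hx
  refine Submodule.span_le.mpr (Set.iUnion_subset fun i => ?_)
  rintro _ ⟨x, hx, rfl⟩
  refine Submodule.subset_span (Set.mem_iUnion.mpr ⟨i, S.F x, hA x hx, ?_⟩)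
  exact (Function.Commute.iterate_right (f := S.F) (g := S.τ) S.F_τ i x).symm

/-- The vectors `v, T v, …, T^{m-1} v` are linearly independent modulo `F Λ`. -/
def IndepMod (Λ : Submodule R N) (v : N) (m : ℕ) : Prop :=
  ∀ a : ℕ → R, ∑ i ∈ Finset.range m, a i • S.T^[i] v ∈ Λ.map S.F → ∀ i < m, ϖ ∣ a i

variable {Λ : Submodule R N} {v : N}

theorem smul_mem_map (hF : ∀ x ∈ Λ, S.F x ∈ Λ) (hT : ∀ x ∈ Λ, S.T x ∈ Λ) {x : N} (hx : x ∈ Λ) :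
    ϖ • x ∈ Λ.map S.F :=
  ⟨_, hF _ (hT _ hx), (S.smul_eq x).symm⟩

theorem iterate_T_mem (hT : ∀ x ∈ Λ, S.T x ∈ Λ) (hv : v ∈ Λ) (i : ℕ) : S.T^[i] v ∈ Λ := by
  induction i with
  | zero => exact hv
  | succ i ih =>
    rw [Function.iterate_succ_apply']
    exact hT _ ih

theorem Z_le (hT : ∀ x ∈ Λ, S.T x ∈ Λ) (hv : v ∈ Λ) (m : ℕ) : S.Z v m ≤ Λ := by
  refine Submodule.span_le.mpr ?_
  rintro _ ⟨i, rfl⟩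
  exact S.iterate_T_mem hT hv i

theorem iterate_F_mem (hF : ∀ x ∈ Λ, S.F x ∈ Λ) {x : N} (hx : x ∈ Λ) (i : ℕ) : S.F^[i] x ∈ Λ := by
  induction i with
  | zero => exact hx
  | succ i ih =>
    rw [Function.iterate_succ_apply']
    exact hF _ ih

theorem D_le_Φ (hF : ∀ x ∈ Λ, S.F x ∈ Λ) (hT : ∀ x ∈ Λ, S.T x ∈ Λ) (hv : v ∈ Λ) (n : ℕ) :
    S.D v n ≤ S.Φ n Λ := by
  refine Submodule.span_le.mpr ?_
  rintro _ ⟨m, i, hm, -, rfl⟩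
  refine S.mem_Φ.mpr ⟨S.F^[m - n] (S.T^[i] v),
    S.iterate_F_mem hF (S.iterate_T_mem hT hv i) _, ?_⟩
  rw [← Function.iterate_add_apply, Nat.add_sub_cancel' hm]

theorem IndepMod.mono {m n : ℕ} (h : S.IndepMod Λ v n) (hmn : m ≤ n) : S.IndepMod Λ v m := by
  intro a ha i hi
  have := h (fun j => if j < m then a j else 0) ?_ i (by omega)
  · simpa [hi] using this
  · convert ha using 1
    rw [← Finset.sum_subset (Finset.range_subset_range.mpr hmn)]
    · exact Finset.sum_congr rfl fun j hj => by simp [Finset.mem_range.mp hj]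
    · intro j _ hj
      simp [show ¬ j < m by simpa using hj]

theorem IndepMod.pow_dvd (hϖ : ∀ x : N, ϖ • x = 0 → x = 0)
    (hT : ∀ x ∈ Λ, S.T x ∈ Λ) (hv : v ∈ Λ) {m : ℕ}
    (h : S.IndepMod Λ v m) (n : ℕ) (a b : ℕ → R)
    (hab : ∑ i ∈ Finset.range m, a i • S.T^[i] v + ∑ i ∈ Finset.range m, b i • S.F (S.T^[i] v) = 0) :
    ∀ i < m, ϖ ^ n ∣ a i ∧ ϖ ^ n ∣ b i := by
  have exists_mul : ∀ c : ℕ → R, (∀ i < m, ϖ ∣ c i) → ∃ c' : ℕ → R, ∀ i < m, c i = ϖ * c' i := by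
    intro c hc
    choose! c' hc' using hc
    exact ⟨c', hc'⟩
  induction n generalizing a b with
  | zero => simp
  | succ n ih =>
    choose b' hb' using fun i => S.σ_surj (b i)
    have hb : ∑ i ∈ Finset.range m, b i • S.F (S.T^[i] v) =
        S.F (∑ i ∈ Finset.range m, b' i • S.T^[i] v) := by
      simp [map_sum, map_smulₛₗ, hb']
    have hmem : ∀ c : ℕ → R, ∑ i ∈ Finset.range m, c i • S.T^[i] v ∈ Λ := fun c =>
      S.Z_le hT hv m (S.mem_Z.mpr ⟨c, rfl⟩)
    obtain ⟨a', ha'⟩ := exists_mul a (h a (by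
      rw [eq_neg_of_add_eq_zero_left hab, hb]
      exact neg_mem ⟨_, hmem b', rfl⟩))
    have ha : ∑ i ∈ Finset.range m, a i • S.T^[i] v =
        ϖ • ∑ i ∈ Finset.range m, a' i • S.T^[i] v := by
      rw [Finset.smul_sum]
      exact Finset.sum_congr rfl fun i hi => by rw [ha' i (Finset.mem_range.mp hi), mul_smul]
    have hb'' : ∀ i < m, ϖ ∣ b i := by
      intro i hi
      suffices hmap : ∑ i ∈ Finset.range m, b' i • S.T^[i] v ∈ Λ.map S.F by
        simpa only [S.σ_ϖ, hb'] using map_dvd S.σ (h b' hmap i hi)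
      refine ⟨-S.T (∑ i ∈ Finset.range m, a' i • S.T^[i] v), neg_mem (hT _ (hmem a')), ?_⟩
      refine S.F_inj ?_
      rw [map_neg, map_neg, ← S.smul_eq, ← ha, ← hb]
      exact neg_eq_of_add_eq_zero_right hab
    obtain ⟨c, hc⟩ := exists_mul b hb''
    have := ih a' c (hϖ _ (by
      rw [← hab, smul_add, ha, Finset.smul_sum (s := Finset.range m) (f := fun i => c i • _)]
      congr 1
      exact Finset.sum_congr rfl fun i hi => by rw [hc i (Finset.mem_range.mp hi), mul_smul]))
    intro i hi
    rw [ha' i hi, hc i hi, pow_succ']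
    exact ⟨mul_dvd_mul_left _ (this i hi).1, mul_dvd_mul_left _ (this i hi).2⟩

/-- The family `v, T v, …, T^{m-1} v, F v, F T v, …, F T^{m-1} v`. -/
def family (v : N) (m : ℕ) : Fin m ⊕ Fin m → N :=
  Sum.elim (fun i => S.T^[i] v) fun i => S.F (S.T^[i] v)

theorem IndepMod.linearIndependent (hsep : ∀ a : R, (∀ n, ϖ ^ n ∣ a) → a = 0)
    (hϖ : ∀ x : N, ϖ • x = 0 → x = 0)
    (hT : ∀ x ∈ Λ, S.T x ∈ Λ) (hv : v ∈ Λ) {m : ℕ}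
    (h : S.IndepMod Λ v m) : LinearIndependent R (S.family v m) := by
  rw [Fintype.linearIndependent_iff]
  intro c hc
  have key := fun n => IndepMod.pow_dvd S hϖ hT hv h n
    (fun i => if hi : i < m then c (.inl ⟨i, hi⟩) else 0)
    (fun i => if hi : i < m then c (.inr ⟨i, hi⟩) else 0) (by
      rw [← hc, Fintype.sum_sum_type,
        ← Fin.sum_univ_eq_sum_range fun i => (if hi : i < m then c (.inl ⟨i, hi⟩) else 0) • _,
        ← Fin.sum_univ_eq_sum_range fun i => (if hi : i < m then c (.inr ⟨i, hi⟩) else 0) • _]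
      simp [family])
  rintro (i | i)
  · refine hsep _ fun n => ?_
    simpa using (key n i i.2).1
  · refine hsep _ fun n => ?_
    simpa using (key n i i.2).2

theorem le_span_family [IsNoetherian R Λ] (hjac : Ideal.span {ϖ} ≤ (⊥ : Ideal R).jacobson)
    (hτ : ∀ x ∈ Λ, S.τ x ∈ Λ) {m : ℕ}
    (h : Λ ≤ S.Z v m ⊔ Λ.map S.F) : Λ ≤ Submodule.span R (Set.range (S.family v m)) := by
  refine Submodule.le_of_le_smul_of_le_jacobson_bot
    (isNoetherian_submodule.mp ‹_› Λ le_rfl) hjac ?_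
  have hZ : S.Z v m ≤ Submodule.span R (Set.range (S.family v m)) := by
    refine Submodule.span_mono ?_
    rintro _ ⟨i, rfl⟩
    exact ⟨.inl i, rfl⟩
  have hFZ : (S.Z v m).map S.F ≤ Submodule.span R (Set.range (S.family v m)) := by
    rw [Z, Submodule.map_span]
    refine Submodule.span_mono ?_
    rintro _ ⟨_, ⟨i, rfl⟩, rfl⟩
    exact ⟨.inr i, rfl⟩
  have hFF : (Λ.map S.F).map S.F ≤ Ideal.span {ϖ} • Λ := by
    rintro _ ⟨_, ⟨x, hx, rfl⟩, rfl⟩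
    rw [S.F_F]
    exact Submodule.smul_mem_smul (Ideal.mem_span_singleton_self ϖ) (hτ x hx)
  refine h.trans (sup_le (hZ.trans le_sup_left) ((Submodule.map_mono h).trans ?_))
  rw [Submodule.map_sup]
  exact sup_le_sup hFZ hFF

theorem IndepMod.T_mem_sup (hunit : ∀ a : R, ¬ ϖ ∣ a → IsUnit a)
    (hF : ∀ x ∈ Λ, S.F x ∈ Λ) (hT : ∀ x ∈ Λ, S.T x ∈ Λ) (hv : v ∈ Λ) {m : ℕ}
    (h : S.IndepMod Λ v m) (h' : ¬ S.IndepMod Λ v (m + 1)) :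
    S.T^[m] v ∈ S.Z v m ⊔ Λ.map S.F := by
  simp only [IndepMod, not_forall] at h'
  obtain ⟨a, ha, i, hi, hai⟩ := h'
  rw [Finset.sum_range_succ] at ha
  by_cases hm : ϖ ∣ a m
  · have : a m • S.T^[m] v ∈ Λ.map S.F := by
      obtain ⟨c, hc⟩ := hm
      rw [hc, mul_comm, mul_smul]
      exact Submodule.smul_mem _ _ (S.smul_mem_map hF hT (S.iterate_T_mem hT hv m))
    have := h a ((Submodule.add_mem_iff_left _ this).mp ha)
    rcases Nat.lt_succ_iff_lt_or_eq.mp hi with hi | rfl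
    · exact absurd (this i hi) hai
    · exact absurd hm hai
  · obtain ⟨u, hu⟩ := hunit _ hm
    rw [← hu] at ha
    have : (u : R) • S.T^[m] v ∈ S.Z v m ⊔ Λ.map S.F :=
      (Submodule.add_mem_iff_right _ (Submodule.mem_sup_left (S.mem_Z.mpr ⟨a, rfl⟩))).mp
        (Submodule.mem_sup_right ha)
    have := Submodule.smul_mem _ (↑u⁻¹ : R) this
    rwa [smul_smul, Units.inv_mul, one_smul] at this

/-- If `T^m v` lies in the span of its predecessors modulo `F Λ`, then these generate
`Λ = ∑ τ^i (D v)` modulo `F Λ`. -/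
theorem Aτ_le_sup (B : Submodule R N) [IsNoetherian R B] (hB : ∀ x, S.T x ∈ B → x ∈ B)
    (hAB : S.Aτ (S.D v 0) ≤ B)
    (hT : ∀ x ∈ S.Aτ (S.D v 0), S.T x ∈ S.Aτ (S.D v 0)) (hv : v ∈ S.Aτ (S.D v 0)) {m : ℕ}
    (hm : S.T^[m] v ∈ S.Z v m ⊔ (S.Aτ (S.D v 0)).map S.F) :
    S.Aτ (S.D v 0) ≤ S.Z v m ⊔ (S.Aτ (S.D v 0)).map S.F := by
  have hF : ∀ x ∈ S.Aτ (S.D v 0), S.F x ∈ S.Aτ (S.D v 0) := fun x hx =>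
    S.F_mem_Aτ (fun _ => S.F_mem_D) hx
  have hsupT : ∀ x ∈ S.Z v m ⊔ (S.Aτ (S.D v 0)).map S.F,
      S.T x ∈ S.Z v m ⊔ (S.Aτ (S.D v 0)).map S.F := by
    suffices h : S.Z v m ⊔ (S.Aτ (S.D v 0)).map S.F ≤
        (S.Z v m ⊔ (S.Aτ (S.D v 0)).map S.F).comap S.T from fun x hx => h hx
    refine sup_le (Submodule.span_le.mpr ?_) ?_
    · rintro _ ⟨i, rfl⟩
      rw [SetLike.mem_coe, Submodule.mem_comap, ← Function.iterate_succ_apply' S.T]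
      rcases (Nat.succ_le_of_lt i.2).lt_or_eq with hi | hi
      · exact Submodule.mem_sup_left (S.T_mem_Z v hi)
      · rw [hi]
        exact hm
    · rintro _ ⟨x, hx, rfl⟩
      exact Submodule.mem_sup_right ⟨S.T x, hT x hx, S.F_T x⟩
  have hsupB : S.Z v m ⊔ (S.Aτ (S.D v 0)).map S.F ≤ B := by
    refine le_trans (sup_le (S.Z_le hT hv m) ?_) hAB
    rintro _ ⟨x, hx, rfl⟩
    exact hF x hx
  refine S.Aτ_le (Submodule.span_le.mpr ?_) fun x hx =>
    mem_of_map_mem S.T (fun y => ⟨S.τ y, S.T_τ y⟩) B _ hB hsupB hsupT (by rwa [S.T_τ])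
  rintro _ ⟨n, i, -, hi, rfl⟩
  rcases n with _ | n
  · obtain rfl : i = 0 := by omega
    rcases m with _ | m
    · exact hm
    · exact Submodule.mem_sup_left (S.T_mem_Z v m.succ_pos)
  · rw [Function.iterate_succ_apply']
    exact Submodule.mem_sup_right ⟨_, S.iterate_F_mem hF (S.iterate_T_mem hT hv i) n, rfl⟩

/-- If `v, …, T^{g-1} v` generate `Λ` modulo `F Λ`, then `F^{g-1} Λ` is contained in `D v`. -/
theorem Φ_le_D [IsNoetherian R Λ] (hjac : Ideal.span {ϖ} ≤ (⊥ : Ideal R).jacobson)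
    (hF : ∀ x ∈ Λ, S.F x ∈ Λ) (hτ : ∀ x ∈ Λ, S.τ x ∈ Λ) {n : ℕ}
    (h : Λ ≤ S.Z v (n + 1) ⊔ Λ.map S.F) : S.Φ n Λ ≤ S.D v 0 := by
  have hΦΛ : S.Φ n Λ ≤ Λ := by
    intro x hx
    obtain ⟨y, hy, rfl⟩ := S.mem_Φ.mp hx
    exact S.iterate_F_mem hF hy n
  refine Submodule.le_of_le_smul_of_le_jacobson_bot
    (isNoetherian_submodule.mp ‹_› _ hΦΛ) hjac ?_
  have h1 : S.Φ n Λ ≤ S.D v 0 ⊔ (S.Φ n Λ).map S.F := by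
    refine (S.Φ_mono n h).trans ?_
    rw [Φ_sup, Φ_map, map_Φ]
    exact sup_le_sup_right ((S.Φ_Z_le_D v n).trans (S.D_anti v n.zero_le)) _
  refine h1.trans (sup_le le_sup_left ((Submodule.map_mono h1).trans ?_))
  rw [Submodule.map_sup]
  refine sup_le_sup ?_ ?_
  · rintro _ ⟨x, hx, rfl⟩
    exact S.F_mem_D hx
  · rintro _ ⟨_, ⟨x, hx, rfl⟩, rfl⟩
    rw [S.F_F]
    obtain ⟨y, hy, rfl⟩ := S.mem_Φ.mp hx
    rw [← S.iterate_F_τ]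
    exact Submodule.smul_mem_smul (Ideal.mem_span_singleton_self ϖ)
      (S.mem_Φ.mpr ⟨_, hτ y hy, rfl⟩)

theorem IndepMod.D_inf_Φ_le (hF : ∀ x ∈ Λ, S.F x ∈ Λ) (hT : ∀ x ∈ Λ, S.T x ∈ Λ) (hv : v ∈ Λ)
    {n : ℕ} (h : S.IndepMod Λ v n) : S.D v 0 ⊓ S.Φ n Λ ≤ S.D v n := by
  induction n with
  | zero => exact inf_le_left
  | succ n ih =>
    rintro x ⟨hxD, hxΦ⟩
    have hΦn : S.Φ (n + 1) Λ ≤ S.Φ n Λ := by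
      rw [← Φ_map]
      refine S.Φ_mono n ?_
      rintro _ ⟨y, hy, rfl⟩
      exact hF y hy
    have hx := S.D_le_sup v n (ih (IndepMod.mono S h n.le_succ) ⟨hxD, hΦn hxΦ⟩)
    obtain ⟨_, hFz, y, hy, rfl⟩ := Submodule.mem_sup.mp hx
    refine add_mem ?_ hy
    have hzΦ := (Submodule.add_mem_iff_left _ (S.D_le_Φ hF hT hv _ hy)).mp hxΦ
    obtain ⟨z, hz, rfl⟩ := S.mem_Φ.mp hFz
    obtain ⟨_, ⟨u, hu, rfl⟩, hzu⟩ := S.mem_Φ.mp ((S.Φ_map n Λ).symm ▸ hzΦ)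
    obtain rfl := S.F_inj.iterate n hzu
    obtain ⟨a, ha⟩ := S.mem_Z.mp hz
    have hdvd := h a (ha ▸ ⟨u, hu, rfl⟩)
    choose! c hc using hdvd
    have : S.F u = ϖ • ∑ i ∈ Finset.range (n + 1), c i • S.T^[i] v := by
      rw [← ha, Finset.smul_sum]
      exact Finset.sum_congr rfl fun i hi => by rw [hc i (Finset.mem_range.mp hi), mul_smul]
    rw [this, iterate_F_smul]
    exact S.smul_mem_D (S.Φ_Z_le_D v n (S.mem_Φ.mpr ⟨_, S.mem_Z.mpr ⟨c, rfl⟩, rfl⟩))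

/-- A vector all of whose `τ`-translates lie, modulo `F Λ`, in the span of fewer than `g` of the
independent vectors `v, …, T^{g-1} v` belongs to `F Λ`. -/
theorem IndepMod.mem_map_of_forall (hF : ∀ x ∈ Λ, S.F x ∈ Λ) (hT : ∀ x ∈ Λ, S.T x ∈ Λ)
    (hv : v ∈ Λ) {n : ℕ} (h : S.IndepMod Λ v (n + 1)) {y : N}
    (hy : ∀ j, S.τ^[j] y ∈ S.Z v n ⊔ Λ.map S.F) : y ∈ Λ.map S.F := by
  have hrep : ∀ j, ∃ a : ℕ → R,
      S.τ^[j] y - ∑ i ∈ Finset.range n, a i • S.T^[i] v ∈ Λ.map S.F := by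
    intro j
    obtain ⟨z, hz, f, hf, hzf⟩ := Submodule.mem_sup.mp (hy j)
    obtain ⟨a, rfl⟩ := S.mem_Z.mp hz
    exact ⟨a, by rwa [← hzf, add_sub_cancel_left]⟩
  choose a ha using hrep
  have hdiff : ∀ j, ∀ i < n + 1,
      ϖ ∣ (if i < n then a j i else 0) - (if i = 0 then 0 else S.ρ' (a (j + 1) (i - 1))) := by
    intro j
    apply h
    have h1 : S.T (S.τ^[j + 1] y - ∑ i ∈ Finset.range n, a (j + 1) i • S.T^[i] v) ∈ Λ.map S.F := by
      obtain ⟨u, hu, hu'⟩ := ha (j + 1)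
      rw [← hu', ← S.F_T]
      exact ⟨_, hT u hu, rfl⟩
    rw [Function.iterate_succ_apply', map_sub, S.T_τ, map_sum] at h1
    convert sub_mem h1 (ha j) using 1
    simp only [sub_smul, Finset.sum_sub_distrib]
    rw [Finset.sum_range_succ, Finset.sum_range_succ' (fun i => (if i = 0 then (0 : R) else _) • _)]
    simp only [lt_irrefl, if_false, if_true, zero_smul, add_zero, Nat.succ_ne_zero,
      Nat.add_sub_cancel, sub_sub_sub_cancel_left]
    congr 1
    · exact Finset.sum_congr rfl fun i hi => by rw [if_pos (Finset.mem_range.mp hi)]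
    · exact Finset.sum_congr rfl fun i _ => by rw [map_smulₛₗ, Function.iterate_succ_apply']
  have hdvd : ∀ i < n, ∀ j, ϖ ∣ a j i := by
    intro i
    induction i with
    | zero =>
      intro hi j
      simpa [hi] using hdiff j 0 n.succ_pos
    | succ i ih =>
      intro hi j
      have h1 := hdiff j (i + 1) (by omega)
      rw [if_pos hi, if_neg i.succ_ne_zero, Nat.add_sub_cancel] at h1
      refine (dvd_sub_left ?_).mp h1
      simpa [S.ρ'_ϖ] using map_dvd S.ρ' (ih (by omega) (j + 1))
  have hsum : ∑ i ∈ Finset.range n, a 0 i • S.T^[i] v ∈ Λ.map S.F := by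
    refine sum_mem fun i hi => ?_
    obtain ⟨c, hc⟩ := hdvd i (Finset.mem_range.mp hi) 0
    rw [hc, mul_comm, mul_smul]
    exact Submodule.smul_mem _ _ (S.smul_mem_map hF hT (S.iterate_T_mem hT hv i))
  exact (Submodule.sub_mem_iff_left _ hsum).mp (ha 0)

theorem IndepMod.mem_Φ_of_forall (hF : ∀ x ∈ Λ, S.F x ∈ Λ) (hτ : ∀ x ∈ Λ, S.τ x ∈ Λ)
    (hT : ∀ x ∈ Λ, S.T x ∈ Λ) (hv : v ∈ Λ) {n : ℕ} (h : S.IndepMod Λ v (n + 1)) {x : N}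
    (hx : ∀ j, S.τ^[j] x ∈ S.D v 0) : x ∈ S.Φ n Λ := by
  induction n with
  | zero => exact S.D_le_Φ hF hT hv 0 (hx 0)
  | succ n ih =>
    obtain ⟨y, hy, rfl⟩ := S.mem_Φ.mp (ih (IndepMod.mono S h (n + 1).le_succ))
    have hτy : ∀ j, S.τ^[j] y ∈ Λ := by
      intro j
      induction j with
      | zero => exact hy
      | succ j ih =>
        rw [Function.iterate_succ_apply']
        exact hτ _ ih
    have hcomm : ∀ j, S.τ^[j] (S.F^[n] y) = S.F^[n] (S.τ^[j] y) := fun j =>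
      (Function.Commute.iterate_iterate (f := S.F) (g := S.τ) S.F_τ n j y).symm
    rw [← Φ_map]
    refine S.mem_Φ.mpr ⟨y, IndepMod.mem_map_of_forall S hF hT hv h fun j => ?_, rfl⟩
    have hj := S.D_le_sup v n (IndepMod.D_inf_Φ_le S hF hT hv
      (IndepMod.mono S h (by omega)) ⟨hx j, S.mem_Φ.mpr ⟨_, hτy j, (hcomm j).symm⟩⟩)
    have hle : S.Φ n (S.Z v (n + 1)) ⊔ S.D v (n + 1) ≤
        S.Φ n (S.Z v (n + 1) ⊔ Λ.map S.F) := by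
      rw [Φ_sup, Φ_map]
      exact sup_le_sup_left (S.D_le_Φ hF hT hv _) _
    obtain ⟨z, hz, hzj⟩ := S.mem_Φ.mp (hle hj)
    rw [hcomm] at hzj
    exact S.F_inj.iterate n hzj ▸ hz

theorem Φ_Aτ_maximal (hsep : ∀ a : R, (∀ n, ϖ ^ n ∣ a) → a = 0)
    (hϖ : ∀ x : N, ϖ • x = 0 → x = 0) (hunit : ∀ a : R, ¬ ϖ ∣ a → IsUnit a)
    (hjac : Ideal.span {ϖ} ≤ (⊥ : Ideal R).jacobson)
    (B : Submodule R N) [IsNoetherian R B] (hBτ : ∀ x, S.τ x ∈ B ↔ x ∈ B) (v : N)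
    (hDB : S.D v 0 ≤ B) (n : ℕ)
    (hindep : ∀ m, LinearIndependent R (S.family v m) → m ≤ n + 1)
    (hspan : ∀ m, S.D v 0 ≤ Submodule.span R (Set.range (S.family v m)) → n + 1 ≤ m) :
    S.Φ n (S.Aτ (S.D v 0)) ≤ S.D v 0 ∧
      ∀ x, (∀ j, S.τ^[j] x ∈ S.D v 0) → x ∈ S.Φ n (S.Aτ (S.D v 0)) := by
  set Λ := S.Aτ (S.D v 0) with hΛ
  have hF : ∀ x ∈ Λ, S.F x ∈ Λ := fun x hx => S.F_mem_Aτ (fun _ => S.F_mem_D) hx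
  have hτ : ∀ x ∈ Λ, S.τ x ∈ Λ := fun x hx => S.τ_mem_Aτ hx
  have hΛB : Λ ≤ B := S.Aτ_le hDB fun x hx => (hBτ x).mpr hx
  have hT : ∀ x ∈ Λ, S.T x ∈ Λ := fun x hx =>
    mem_of_map_mem S.τ (fun y => ⟨S.T y, S.τ_T y⟩) B Λ (fun x => (hBτ x).mp) hΛB hτ
      (by rwa [S.τ_T])
  have hv : v ∈ Λ := S.le_Aτ _ (Submodule.subset_span ⟨0, 0, le_rfl, le_rfl, rfl⟩)
  have : IsNoetherian R Λ := isNoetherian_of_le hΛB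
  have hbound : ∀ m, S.IndepMod Λ v m → m ≤ n + 1 := fun m hm =>
    hindep m (IndepMod.linearIndependent S hsep hϖ hT hv hm)
  obtain ⟨m, hm, hm'⟩ : ∃ m, S.IndepMod Λ v m ∧ ¬ S.IndepMod Λ v (m + 1) := by
    by_contra! hcon
    have hall : ∀ m, S.IndepMod Λ v m := by
      intro m
      induction m with
      | zero => exact fun a _ i hi => absurd hi i.not_lt_zero
      | succ m ih => exact hcon m ih
    have := hbound _ (hall (n + 2))
    omega
  have hgen : Λ ≤ S.Z v m ⊔ Λ.map S.F :=
    S.Aτ_le_sup B (fun x hx => by rw [← S.τ_T x]; exact (hBτ _).mpr hx) hΛB hT hv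
      (IndepMod.T_mem_sup S hunit hF hT hv hm hm')
  obtain rfl : m = n + 1 :=
    (hbound m hm).antisymm (hspan m ((S.le_Aτ _).trans (S.le_span_family hjac hτ hgen)))
  exact ⟨S.Φ_le_D hjac hF hτ hgen, fun x hx => IndepMod.mem_Φ_of_forall S hF hτ hT hv hm hx⟩

end TwistedFrobenius

set_option linter.unusedSectionVars false

theorem sigmaK_algebraMap (a : WittVector p k) :
    sigmaK p k (algebraMap _ K(p, k) a) = algebraMap _ K(p, k) (frobeniusEquiv p k a) :=
  IsFractionRing.ringEquivOfRingEquiv_algebraMap _ a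

theorem sigmaK_symm_algebraMap (a : WittVector p k) :
    (sigmaK p k).symm (algebraMap _ K(p, k) a) =
      algebraMap _ K(p, k) ((frobeniusEquiv p k).symm a) := by
  rw [RingEquiv.symm_apply_eq, sigmaK_algebraMap, RingEquiv.apply_symm_apply]

theorem smul_fst_apply (a : WittVector p k) (x : Nspace p k g) (i : Fin g) :
    (a • x).1 i = algebraMap _ K(p, k) a * x.1 i :=
  Algebra.smul_def a (x.1 i)

theorem smul_snd_apply (a : WittVector p k) (x : Nspace p k g) (i : Fin g) :
    (a • x).2 i = algebraMap _ K(p, k) a * x.2 i :=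
  Algebra.smul_def a (x.2 i)

theorem natCast_ne_zero : (p : K(p, k)) ≠ 0 := by
  have := WittVector.p_nonzero p k
  exact_mod_cast (map_ne_zero_iff _ (IsFractionRing.injective _ K(p, k))).mpr this

/-- The inverse of `τ`. -/
def tauInv (x : Nspace p k g) : Nspace p k g :=
  (fun i => (sigmaK p k).symm ((sigmaK p k).symm (x.1 i)),
    fun i => (sigmaK p k).symm ((sigmaK p k).symm (x.2 i)))

theorem tauMap_tauInv (x : Nspace p k g) : tauMap p k g (tauInv p k g x) = x := by
  ext <;> simp [tauMap, tauInv]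

theorem tauInv_tauMap (x : Nspace p k g) : tauInv p k g (tauMap p k g x) = x := by
  ext <;> simp [tauMap, tauInv]

theorem Fmap_Fmap (x : Nspace p k g) :
    Fmap p k g (Fmap p k g x) = (p : WittVector p k) • tauMap p k g x := by
  ext <;> simp [tauMap, Fmap, Algebra.smul_def]

theorem Fmap_tauInv (x : Nspace p k g) :
    Fmap p k g (tauInv p k g x) = tauInv p k g (Fmap p k g x) := by
  ext <;> simp [tauInv, Fmap]

theorem Vmap_eq (x : Nspace p k g) : Vmap p k g x = Fmap p k g (tauInv p k g x) := by
  ext <;> simp [Fmap, Vmap, tauInv]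

theorem Fmap_injective : Function.Injective (Fmap p k g) := fun x y h => by
  ext i
  · exact (sigmaK p k).injective (congrFun (congrArg Prod.snd h) i)
  · exact (sigmaK p k).injective
      (mul_left_cancel₀ (natCast_ne_zero p k) (congrFun (congrArg Prod.fst h) i))

/-- The operators `F`, `τ`, `τ⁻¹` on `N`, as semilinear maps over `W`. -/
def twistedFrobenius : TwistedFrobenius (p : WittVector p k) (Nspace p k g) where
  σ := (frobeniusEquiv p k : WittVector p k →+* WittVector p k)
  ρ := ((frobeniusEquiv p k).trans (frobeniusEquiv p k) : WittVector p k ≃+* WittVector p k)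
  ρ' := ((frobeniusEquiv p k).symm.trans (frobeniusEquiv p k).symm :
    WittVector p k ≃+* WittVector p k)
  F :=
    { toFun := Fmap p k g
      map_add' := fun x y => by ext <;> simp [Fmap, mul_add]
      map_smul' := fun a x => by
        ext <;> simp only [Fmap, smul_fst_apply, smul_snd_apply, map_mul, sigmaK_algebraMap,
          RingEquiv.coe_toRingHom]
        ring }
  τ :=
    { toFun := tauMap p k g
      map_add' := fun x y => by ext <;> simp [tauMap]
      map_smul' := fun a x => by
        ext <;> simp only [tauMap, smul_fst_apply, smul_snd_apply, map_mul, sigmaK_algebraMap,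
          RingEquiv.coe_toRingHom, RingEquiv.trans_apply] }
  T :=
    { toFun := tauInv p k g
      map_add' := fun x y => by ext <;> simp [tauInv]
      map_smul' := fun a x => by
        ext <;> simp only [tauInv, smul_fst_apply, smul_snd_apply, map_mul,
          sigmaK_symm_algebraMap, RingEquiv.coe_toRingHom, RingEquiv.trans_apply] }
  σ_surj := (frobeniusEquiv p k).surjective
  σ_ϖ := map_natCast _ p
  ρ'_ϖ := map_natCast _ p
  F_inj := Fmap_injective p k g
  τ_T := tauMap_tauInv p k g
  T_τ := tauInv_tauMap p k g
  F_F := Fmap_Fmap p k g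
  F_T := Fmap_tauInv p k g

theorem Vmap_iterate (b : ℕ) (x : Nspace p k g) :
    (Vmap p k g)^[b] x =
      (twistedFrobenius p k g).F^[b] ((twistedFrobenius p k g).T^[b] x) := by
  have : Vmap p k g = (twistedFrobenius p k g).F ∘ (twistedFrobenius p k g).T :=
    funext (Vmap_eq p k g)
  rw [this, Function.Commute.comp_iterate (twistedFrobenius p k g).F_T]
  rfl

theorem Dspan_eq (v : Nspace p k g) : Dspan p k g v = (twistedFrobenius p k g).D v 0 := by
  refine congrArg (Submodule.span _) (Set.ext fun w => ⟨?_, ?_⟩)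
  · rintro ⟨a, b, rfl⟩
    refine ⟨a + b, b, Nat.zero_le _, Nat.le_add_left _ _, ?_⟩
    rw [Vmap_iterate, Function.iterate_add_apply]
    rfl
  · rintro ⟨m, i, -, hi, rfl⟩
    refine ⟨m - i, i, ?_⟩
    obtain ⟨a, rfl⟩ := Nat.exists_eq_add_of_le' hi
    rw [Vmap_iterate, Nat.add_sub_cancel, Function.iterate_add_apply]
    rfl

/-- The standard lattice `W^{2g}` in `N`. -/
def standardLattice : Submodule (WittVector p k) (Nspace p k g) :=
  LinearMap.range (LinearMap.prodMap
    ((Algebra.linearMap (WittVector p k) K(p, k)).compLeft (Fin g))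
    ((Algebra.linearMap (WittVector p k) K(p, k)).compLeft (Fin g)))

theorem mem_standardLattice {x : Nspace p k g} : x ∈ standardLattice p k g ↔
    (∀ i, ∃ a, algebraMap (WittVector p k) K(p, k) a = x.1 i) ∧
      ∀ i, ∃ a, algebraMap (WittVector p k) K(p, k) a = x.2 i := by
  constructor
  · rintro ⟨a, rfl⟩
    exact ⟨fun i => ⟨a.1 i, rfl⟩, fun i => ⟨a.2 i, rfl⟩⟩
  · rintro ⟨h1, h2⟩
    choose a ha using h1
    choose b hb using h2
    exact ⟨(a, b), Prod.ext (funext ha) (funext hb)⟩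

/-- The lattice `p^{-n} W^{2g}`. -/
def scaledLattice (n : ℕ) : Submodule (WittVector p k) (Nspace p k g) :=
  (standardLattice p k g).comap (LinearMap.lsmul _ _ ((p : WittVector p k) ^ n))

theorem smul_eq_zero_of_prime (x : Nspace p k g) (h : (p : WittVector p k) • x = 0) : x = 0 :=
  (smul_eq_zero.mp h).resolve_left (WittVector.p_nonzero p k)

instance (n : ℕ) : IsNoetherian (WittVector p k) (scaledLattice p k g n) := by
  have : IsNoetherian (WittVector p k) (standardLattice p k g) := by
    unfold standardLattice
    infer_instance
  refine isNoetherian_of_injective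
    ((LinearMap.lsmul _ _ ((p : WittVector p k) ^ n)).restrict
      (p := scaledLattice p k g n) (q := standardLattice p k g) fun x hx => hx) ?_
  intro x y h
  exact Subtype.ext (smul_right_injective _ (pow_ne_zero n (WittVector.p_nonzero p k))
    (congrArg Subtype.val h))

theorem tauMap_mem_scaledLattice (n : ℕ) (x : Nspace p k g) :
    (twistedFrobenius p k g).τ x ∈ scaledLattice p k g n ↔ x ∈ scaledLattice p k g n := by
  have key : ∀ y : K(p, k), (∃ a, algebraMap (WittVector p k) K(p, k) a =
      (p : K(p, k)) ^ n * sigmaK p k (sigmaK p k y)) ↔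
      ∃ a, algebraMap (WittVector p k) K(p, k) a = (p : K(p, k)) ^ n * y := by
    intro y
    have hy : (p : K(p, k)) ^ n * sigmaK p k (sigmaK p k y) =
        sigmaK p k (sigmaK p k ((p : K(p, k)) ^ n * y)) := by simp
    rw [hy]
    constructor
    · rintro ⟨a, ha⟩
      refine ⟨(frobeniusEquiv p k).symm ((frobeniusEquiv p k).symm a), ?_⟩
      rw [← sigmaK_symm_algebraMap, ← sigmaK_symm_algebraMap, ha]
      simp
    · rintro ⟨a, ha⟩
      exact ⟨frobeniusEquiv p k (frobeniusEquiv p k a), by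
        rw [← sigmaK_algebraMap, ← sigmaK_algebraMap, ha]⟩
  simp only [scaledLattice, Submodule.mem_comap, mem_standardLattice, LinearMap.lsmul_apply,
    smul_fst_apply, smul_snd_apply, map_pow, map_natCast]
  exact and_congr (forall_congr' fun i => key _) (forall_congr' fun i => key _)

theorem exists_pow_mul_eq_algebraMap (y : K(p, k)) :
    ∃ n : ℕ, ∀ m, n ≤ m → ∃ a, algebraMap (WittVector p k) K(p, k) a = (p : K(p, k)) ^ m * y := by
  obtain ⟨b, c, hc, rfl⟩ := IsFractionRing.div_surjective (A := WittVector p k) y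
  obtain ⟨n, u, hu, rfl⟩ := WittVector.exists_eq_pow_p_mul c (nonZeroDivisors.ne_zero hc)
  obtain ⟨u, rfl⟩ := WittVector.isUnit_of_coeff_zero_ne_zero u hu
  refine ⟨n, fun m hm => ⟨(p : WittVector p k) ^ (m - n) * b * (↑u⁻¹ : WittVector p k), ?_⟩⟩
  have hp := natCast_ne_zero p k
  have hu' : algebraMap (WittVector p k) K(p, k) (↑u⁻¹ : WittVector p k) *
      algebraMap (WittVector p k) K(p, k) u = 1 := by
    rw [← map_mul, Units.inv_mul, map_one]
  have hu0 : algebraMap (WittVector p k) K(p, k) u ≠ 0 := right_ne_zero_of_mul_eq_one hu'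
  obtain ⟨d, rfl⟩ := Nat.exists_eq_add_of_le' hm
  rw [Nat.add_sub_cancel, ← mul_div_assoc, eq_div_iff (by simp [hp, hu0])]
  simp only [map_mul, map_pow, map_natCast, pow_add]
  linear_combination (p : K(p, k)) ^ d * p ^ n * algebraMap (WittVector p k) K(p, k) b * hu'

theorem exists_mem_scaledLattice (x : Nspace p k g) :
    ∃ n : ℕ, ∀ m, n ≤ m → x ∈ scaledLattice p k g m := by
  choose n₁ h₁ using fun i => exists_pow_mul_eq_algebraMap p k (x.1 i)
  choose n₂ h₂ using fun i => exists_pow_mul_eq_algebraMap p k (x.2 i)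
  refine ⟨Finset.univ.sup n₁ + Finset.univ.sup n₂, fun m hm => ?_⟩
  simp only [scaledLattice, Submodule.mem_comap, mem_standardLattice, LinearMap.lsmul_apply,
    smul_fst_apply, smul_snd_apply, map_pow, map_natCast]
  have hle₁ := fun i => Finset.le_sup (f := n₁) (Finset.mem_univ i)
  have hle₂ := fun i => Finset.le_sup (f := n₂) (Finset.mem_univ i)
  exact ⟨fun i => h₁ i m ((hle₁ i).trans (by omega)), fun i => h₂ i m ((hle₂ i).trans (by omega))⟩

theorem exists_le_scaledLattice {A : Submodule (WittVector p k) (Nspace p k g)} (hA : A.FG) :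
    ∃ n, A ≤ scaledLattice p k g n := by
  obtain ⟨s, rfl⟩ := hA
  choose n hn using exists_mem_scaledLattice p k g
  exact ⟨s.sup n, Submodule.span_le.mpr fun x hx => hn x _ (Finset.le_sup hx)⟩

theorem finrank_Nspace : Module.finrank K(p, k) (Nspace p k g) = g + g := by
  simp

theorem dvd_or_isUnit (a : WittVector p k) (h : ¬ (p : WittVector p k) ∣ a) : IsUnit a := by
  by_contra ha
  apply h
  rw [← Ideal.mem_span_singleton, ← (WittVector.irreducible p).maximalIdeal_eq]
  exact ha

theorem eq_zero_of_forall_pow_dvd (a : WittVector p k)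
    (h : ∀ n, (p : WittVector p k) ^ n ∣ a) : a = 0 := by
  have hbot := Ideal.iInf_pow_eq_bot_of_isLocalRing (IsLocalRing.maximalIdeal (WittVector p k))
    (IsLocalRing.maximalIdeal.isMaximal _).ne_top
  rw [← Submodule.mem_bot (R := WittVector p k), ← hbot, Submodule.mem_iInf]
  intro n
  rw [(WittVector.irreducible p).maximalIdeal_eq, Ideal.span_singleton_pow,
    Ideal.mem_span_singleton]
  exact h n

/-- Let `v ∈ N` be such that `M := 𝒟v` is a `W`-lattice and set
`Λ₀ = M_τ`. Then `F^{g−1}(Λ₀) ⊆ M`, and every `τ`-stable `W`-lattice contained in `M`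
is contained in `F^{g−1}(Λ₀)`. -/
theorem stmt10 (hg : 1 ≤ g) (v : Nspace p k g) (hv : IsLattice p k g (Dspan p k g v)) :
    ((Fmap p k g)^[g - 1] '' (Mtau p k g (Dspan p k g v) : Set (Nspace p k g))
        ⊆ (Dspan p k g v : Set (Nspace p k g))) ∧
    ∀ L : Submodule (WittVector p k) (Nspace p k g),
      IsLattice p k g L → TauStable p k g L → L ≤ Dspan p k g v →
      (L : Set (Nspace p k g))
        ⊆ (Fmap p k g)^[g - 1] '' (Mtau p k g (Dspan p k g v) : Set (Nspace p k g)) := by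
  set S := twistedFrobenius p k g with hS
  have hMτ : Mtau p k g (Dspan p k g v) = S.Aτ (S.D v 0) := by
    rw [Dspan_eq]
    rfl
  obtain ⟨n, hn⟩ := exists_le_scaledLattice p k g hv.1
  rw [Dspan_eq] at hn
  have himage : ∀ x, x ∈ S.Φ (g - 1) (S.Aτ (S.D v 0)) ↔
      x ∈ (Fmap p k g)^[g - 1] '' (Mtau p k g (Dspan p k g v) : Set (Nspace p k g)) := fun x => by
    rw [hMτ]
    exact S.mem_Φ
  obtain ⟨hle, hmax⟩ := S.Φ_Aτ_maximal (eq_zero_of_forall_pow_dvd p k)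
    (smul_eq_zero_of_prime p k g) (dvd_or_isUnit p k)
    (by
      rw [IsLocalRing.jacobson_eq_maximalIdeal _ bot_ne_top,
        (WittVector.irreducible p).maximalIdeal_eq])
    (scaledLattice p k g n) (tauMap_mem_scaledLattice p k g n) v hn (g - 1)
    (fun m hm => by
      have hK := (LinearIndependent.iff_fractionRing _ K(p, k)).mp hm
      have := hK.fintype_card_le_finrank
      rw [finrank_Nspace, Fintype.card_sum, Fintype.card_fin] at this
      omega)
    (fun m hm => by
      have htop : Submodule.span K(p, k) (Set.range (S.family v m)) = ⊤ := by
        rw [eq_top_iff, ← hv.2, Dspan_eq, Submodule.span_le]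
        intro x hx
        exact Submodule.span_le_restrictScalars (WittVector p k) K(p, k) _ (hm hx)
      have := finrank_range_le_card (R := K(p, k)) (S.family v m)
      rw [Set.finrank, htop, finrank_top, finrank_Nspace, Fintype.card_sum, Fintype.card_fin] at this
      omega)
  refine ⟨fun x hx => ?_, fun L _ hLτ hL x hx => (himage x).mp (hmax x fun j => ?_)⟩
  · rw [Dspan_eq]
    exact hle ((himage x).mpr hx)
  · rw [← Dspan_eq]
    refine hL ?_
    induction j with
    | zero => exact hx
    | succ j ih =>
      rw [Function.iterate_succ_apply']
      exact hLτ _ ih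
end
end

section
/- Let g ≥ 1 and set m = ⌊g/2⌋ + 1. There exist x_1, …, x_m ∈ k such that for every subset S ⊆ {0, 1, …, g} with exactly m elements and with g ∈ S, the m×m matrix (σ^{2j}(x_i))_{1≤i≤m, j∈S} is invertible. -/
open Finset

/-- A generalized Vandermonde determinant in independent variables with pairwise distinct
exponents is a nonzero polynomial. -/
theorem det_X_pow_ne_zero {ι R : Type*} [Fintype ι] [DecidableEq ι] [CommRing R] [Nontrivial R]
    {e : ι → ℕ} (he : Function.Injective e) :
    (Matrix.of fun i j => (MvPolynomial.X i : MvPolynomial ι R) ^ e j).det ≠ 0 := by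
  have hprod (s : Equiv.Perm ι) : ∏ i, (MvPolynomial.X i : MvPolynomial ι R) ^ e (s i) =
      MvPolynomial.monomial (Finsupp.equivFunOnFinite.symm fun i => e (s i)) 1 := by
    rw [MvPolynomial.monomial_eq, Finsupp.prod_fintype _ _ (fun _ => pow_zero _)]
    simp
  have hcoeff : MvPolynomial.coeff (Finsupp.equivFunOnFinite.symm e)
      (Matrix.of fun i j => (MvPolynomial.X i : MvPolynomial ι R) ^ e j).det = 1 := by
    rw [← Matrix.det_transpose, Matrix.det_apply, MvPolynomial.coeff_sum, Finset.sum_eq_single 1]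
    · simp only [Matrix.transpose_apply, Matrix.of_apply, hprod]
      simp
    · intro s _ hs
      simp only [Matrix.transpose_apply, Matrix.of_apply, hprod]
      have hne : (fun i => e (s i)) ≠ e := fun h =>
        hs (Equiv.ext fun i => he (congrFun h i))
      rw [Units.smul_def, MvPolynomial.coeff_smul, MvPolynomial.coeff_monomial,
        if_neg (by simpa using hne), smul_zero]
    · simp
  intro h
  simp [h] at hcoeff

theorem frobeniusEquiv_ringAut_pow_apply (p : ℕ) [Fact p.Prime] (k : Type*) [Field k]
    [CharP k p] [PerfectRing k p] (n : ℕ) (x : k) :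
    ((frobeniusEquiv k p : RingAut k) ^ n) x = x ^ p ^ n := by
  induction n with
  | zero => simp
  | succ n ih =>
    rw [pow_succ', RingAut.mul_apply, ih, frobeniusEquiv_apply, frobenius_def, ← pow_mul, pow_succ]

/-- Let `g ≥ 1` and `m = ⌊g/2⌋ + 1`. There exist `x_1, …, x_m ∈ k` such
that for every subset `S ⊆ {0, 1, …, g}` with exactly `m` elements and `g ∈ S`, the
`m×m` matrix `(σ^(2j)(x_i))_{1≤i≤m, j∈S}` is invertible (i.e. has full rank `m`). -/
theorem stmt14 (p : ℕ) [Fact p.Prime] (k : Type*) [Field k] [IsAlgClosed k] [CharP k p]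
    (g : ℕ) (hg : 1 ≤ g) :
    ∃ x : Fin (g / 2 + 1) → k,
      ∀ S : Finset ℕ, S ⊆ Finset.range (g + 1) → S.card = g / 2 + 1 → g ∈ S →
        (Matrix.of fun (i : Fin (g / 2 + 1)) (j : S) =>
            ((frobeniusEquiv k p : RingAut k) ^ (2 * (j : ℕ))) (x i)).rank
          = g / 2 + 1 := by
  let D (e : Fin (g / 2 + 1) → ℕ) : MvPolynomial (Fin (g / 2 + 1)) k :=
    (Matrix.of fun i j => MvPolynomial.X i ^ p ^ (2 * e j)).det
  -- The exponent vectors `e` range over the injections into `{0, …, g}`.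
  let E := {e ∈ Fintype.piFinset fun _ : Fin (g / 2 + 1) => range (g + 1) | Function.Injective e}
  have hD : ∏ e ∈ E, D e ≠ 0 := by
    refine Finset.prod_ne_zero_iff.mpr fun e he => det_X_pow_ne_zero fun i j hij => ?_
    have := Nat.pow_right_injective (Fact.out : p.Prime).two_le hij
    exact (mem_filter.mp he).2 (by lia)
  obtain ⟨x, hx⟩ : ∃ x, MvPolynomial.eval x (∏ e ∈ E, D e) ≠ 0 := by
    by_contra! h
    exact hD (MvPolynomial.funext fun x => by simpa using h x)
  refine ⟨x, fun S hS hcard _ => ?_⟩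
  let f : Fin (g / 2 + 1) ≃ S := (S.equivFinOfCardEq hcard).symm
  have hf : (fun i => (f i : ℕ)) ∈ E := by
    simp only [E, mem_filter, Fintype.mem_piFinset]
    exact ⟨fun i => hS (f i).2, Subtype.val_injective.comp f.injective⟩
  rw [map_prod, Finset.prod_ne_zero_iff] at hx
  have hdet := hx _ hf
  rw [RingHom.map_det] at hdet
  rw [← Matrix.rank_submatrix _ (Equiv.refl _) f]
  refine (Matrix.rank_of_isUnit _ ?_).trans (Fintype.card_fin _)
  rw [Matrix.isUnit_iff_isUnit_det, isUnit_iff_ne_zero]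
  convert hdet using 2
  ext i j
  simp [frobeniusEquiv_ringAut_pow_apply]
end
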